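/- arXiv:1402.4203 — 4 statements merged into one kernel-verified Lean document; each statement's English description precedes it below -/
import Mathlib

section
/- For every n ≥ 1 there exists a constant C > 0 such that for every strictly upper triangular n×n complex matrix N (N i j = 0 whenever j ≤ i), one has ‖N Nᴴ − Nᴴ N‖ ≥ C ‖N‖², where ‖·‖ is the Frobenius norm. -/
open Matrix

attribute [local instance] Matrix.frobeniusNormedAddCommGroup Matrix.frobeniusNormedRing

/-- The square of the Frobenius norm is the sum of the squared norms of the entries. -/
theorem frobenius_norm_sq_eq_sum {m n : Type*} [Fintype m] [Fintype n] (A : Matrix m n ℂ) :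
    ‖A‖ ^ 2 = ∑ i, ∑ j, ‖A i j‖ ^ 2 := by
  rw [frobenius_norm_def, ← Real.sqrt_eq_rpow, Real.sq_sqrt (by positivity)]
  simp

/-- Each entry of a matrix is bounded by its Frobenius norm. -/
theorem norm_entry_le_frobenius_norm {m n : Type*} [Fintype m] [Fintype n] (A : Matrix m n ℂ)
    (i : m) (j : n) : ‖A i j‖ ≤ ‖A‖ := by
  refine (sq_le_sq₀ (norm_nonneg _) (norm_nonneg _)).1 ?_
  rw [frobenius_norm_sq_eq_sum]
  calc ‖A i j‖ ^ 2 ≤ ∑ j', ‖A i j'‖ ^ 2 :=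
        Finset.single_le_sum (f := fun j' => ‖A i j'‖ ^ 2)
          (fun _ _ => sq_nonneg _) (Finset.mem_univ j)
    _ ≤ ∑ i', ∑ j', ‖A i' j'‖ ^ 2 :=
        Finset.single_le_sum (f := fun i' => ∑ j', ‖A i' j'‖ ^ 2)
          (fun _ _ => Finset.sum_nonneg fun _ _ => sq_nonneg _) (Finset.mem_univ i)

/-- The diagonal entries of `N * Nᴴ - Nᴴ * N` compare the rows of `N` with its columns. -/
theorem re_commutator_conjTranspose_diag {n : Type*} [Fintype n] (N : Matrix n n ℂ) (k : n) :
    ((N * Nᴴ - Nᴴ * N) k k).re = ∑ j, ‖N k j‖ ^ 2 - ∑ j, ‖N j k‖ ^ 2 := by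
  simp [Matrix.mul_apply, Complex.sq_norm, Complex.normSq_apply]

/-- For strictly upper triangular `N`, weighting the diagonal of `N * Nᴴ - Nᴴ * N` by the index
bounds `‖N‖ ^ 2`. -/
theorem frobenius_norm_sq_le_weighted_diag {n : ℕ} (N : Matrix (Fin n) (Fin n) ℂ)
    (hN : ∀ i j : Fin n, j ≤ i → N i j = 0) :
    ‖N‖ ^ 2 ≤ -∑ k : Fin n, (k : ℝ) * ((N * Nᴴ - Nᴴ * N) k k).re := by
  have hsum : -∑ k : Fin n, (k : ℝ) * ((N * Nᴴ - Nᴴ * N) k k).re =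
      ∑ i : Fin n, ∑ j : Fin n, ((j : ℝ) - i) * ‖N i j‖ ^ 2 := by
    simp only [re_commutator_conjTranspose_diag, mul_sub, sub_mul, Finset.mul_sum,
      Finset.sum_sub_distrib, neg_sub]
    rw [Finset.sum_comm]
  rw [hsum, frobenius_norm_sq_eq_sum]
  refine Finset.sum_le_sum fun i _ => Finset.sum_le_sum fun j _ => ?_
  rcases le_or_gt j i with h | h
  · simp [hN i j h]
  · have hij : (i : ℝ) + 1 ≤ j := by exact_mod_cast h
    exact le_mul_of_one_le_left (sq_nonneg _) (by linarith)

/-- For every `n ≥ 1` there is a constant `C > 0` such that every strictly upper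
triangular `n × n` complex matrix `N` satisfies `‖N * Nᴴ - Nᴴ * N‖ ≥ C * ‖N‖ ^ 2`
in the Frobenius norm. -/
theorem exists_commutator_lower_bound_strictly_upper_triangular
    (n : ℕ) (hn : 1 ≤ n) :
    ∃ C : ℝ, 0 < C ∧ ∀ N : Matrix (Fin n) (Fin n) ℂ,
      (∀ i j : Fin n, j ≤ i → N i j = 0) →
      ‖N * Nᴴ - Nᴴ * N‖ ≥ C * ‖N‖ ^ 2 := by
  have hS : (0 : ℝ) ≤ ∑ k : Fin n, (k : ℝ) := Finset.sum_nonneg fun _ _ => Nat.cast_nonneg _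
  refine ⟨((∑ k : Fin n, (k : ℝ)) + 1)⁻¹, by positivity, fun N hN => ?_⟩
  rw [ge_iff_le, inv_mul_le_iff₀ (by positivity)]
  calc ‖N‖ ^ 2 ≤ -∑ k : Fin n, (k : ℝ) * ((N * Nᴴ - Nᴴ * N) k k).re :=
        frobenius_norm_sq_le_weighted_diag N hN
    _ = ∑ k : Fin n, (k : ℝ) * -((N * Nᴴ - Nᴴ * N) k k).re := by
        simp only [mul_neg, Finset.sum_neg_distrib]
    _ ≤ ∑ k : Fin n, (k : ℝ) * ‖N * Nᴴ - Nᴴ * N‖ := by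
        gcongr with k
        exact (neg_le_abs _).trans ((Complex.abs_re_le_norm _).trans
          (norm_entry_le_frobenius_norm _ k k))
    _ ≤ ((∑ k : Fin n, (k : ℝ)) + 1) * ‖N * Nᴴ - Nᴴ * N‖ := by
        rw [← Finset.sum_mul]
        gcongr
        linarith
end

section
/- Simpson's lemma: for every n ≥ 1 and every B > 0 there exist constants C₁ > 0 and C₂ > 0 such that every n×n complex matrix P all of whose eigenvalues λ (i.e. all λ in the spectrum of P) satisfy |λ| ≤ B obeys ‖[P, Pᴴ]‖² ≥ C₁ ‖P‖⁴ − C₂ (1 + ‖P‖²), where ‖·‖ is the Frobenius norm and [A,B] = AB − BA. -/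
open Matrix

attribute [local instance] Matrix.frobeniusNormedAddCommGroup Matrix.frobeniusNormedRing

attribute [local instance] Matrix.frobeniusNormedSpace

open scoped ComplexOrder in
theorem Matrix.IsHermitian.eq_zero_of_isNilpotent {m : Type*} [Fintype m] [DecidableEq m]
    {H : Matrix m m ℂ} (hH : H.IsHermitian) (hn : IsNilpotent H) : H = 0 := by
  have key (k : ℕ) : H ^ 2 ^ k = 0 → H = 0 := by
    induction k with
    | zero => simp
    | succ k ih =>
      intro h
      refine ih (Matrix.conjTranspose_mul_self_eq_zero.mp ?_)
      rw [(hH.pow _).eq, ← pow_add, ← two_mul, ← pow_succ', h]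
  obtain ⟨k, hk⟩ := hn
  exact key k (pow_eq_zero_of_le Nat.lt_two_pow_self.le hk)

open scoped ComplexOrder in
theorem Matrix.eq_zero_of_isNilpotent_of_commute_conjTranspose {m : Type*} [Fintype m]
    [DecidableEq m] {Q : Matrix m m ℂ} (hn : IsNilpotent Q) (hc : Commute Qᴴ Q) : Q = 0 :=
  Matrix.conjTranspose_mul_self_eq_zero.mp <|
    (Matrix.isHermitian_conjTranspose_mul_self Q).eq_zero_of_isNilpotent <|
      hc.isNilpotent_mul_left hn

theorem Matrix.isNilpotent_of_forall_eval_charpoly_ne_zero {m : Type*} [Fintype m]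
    [DecidableEq m] {Q : Matrix m m ℂ} (h : ∀ z ≠ 0, Q.charpoly.eval z ≠ 0) : IsNilpotent Q := by
  have hroots : Q.charpoly.roots = Multiset.replicate (Multiset.card Q.charpoly.roots) 0 :=
    Multiset.eq_replicate_card.mpr fun z hz => by
      by_contra hz0
      exact h z hz0 (Polynomial.isRoot_of_mem_roots hz)
  have hX := (IsAlgClosed.splits Q.charpoly).eq_prod_roots_of_monic Q.charpoly_monic
  rw [hroots] at hX
  refine ⟨Multiset.card Q.charpoly.roots, ?_⟩
  have := Q.aeval_self_charpoly
  rw [hX] at this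
  simpa using this

theorem Matrix.pow_le_norm_eval_charpoly {m : Type*} [Fintype m] [DecidableEq m]
    {Q : Matrix m m ℂ} {b : ℝ} (h : ∀ lam ∈ spectrum ℂ Q, ‖lam‖ ≤ b) (z : ℂ) :
    max (‖z‖ - b) 0 ^ Fintype.card m ≤ ‖Q.charpoly.eval z‖ := by
  have hs := IsAlgClosed.splits Q.charpoly
  rw [hs.eval_eq_prod_roots_of_monic Q.charpoly_monic, ← Q.charpoly_natDegree_eq_dim,
    hs.natDegree_eq_card_roots]
  have hr : ∀ lam ∈ Q.charpoly.roots, ‖lam‖ ≤ b := fun lam hl =>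
    h lam (Matrix.mem_spectrum_of_isRoot_charpoly (Polynomial.isRoot_of_mem_roots hl))
  clear hs h
  generalize Q.charpoly.roots = r at hr ⊢
  induction r using Multiset.induction with
  | empty => simp
  | cons a s ih =>
    simp only [Multiset.card_cons, Multiset.map_cons, Multiset.prod_cons, norm_mul, pow_succ']
    gcongr
    · refine max_le ?_ (norm_nonneg _)
      linarith [norm_sub_norm_le z a, hr a (Multiset.mem_cons_self a s)]
    · exact ih fun lam hl => hr lam (Multiset.mem_cons_of_mem hl)

theorem Matrix.continuous_eval_charpoly {m : Type*} [Fintype m] [DecidableEq m] (z : ℂ) :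
    Continuous fun Q : Matrix m m ℂ => Q.charpoly.eval z := by
  simp only [Matrix.eval_charpoly]
  exact (continuous_const.sub continuous_id).matrix_det

theorem Matrix.exists_pos_le_norm_commutator_sq_add_sq {m : Type*} [Fintype m] [DecidableEq m]
    (B : ℝ) : ∃ ε : ℝ, 0 < ε ∧ ∀ (Q : Matrix m m ℂ) (t : ℝ), ‖Q‖ = 1 → 0 ≤ t → t ≤ 1 →
      (∀ lam ∈ spectrum ℂ Q, ‖lam‖ ≤ t * B) → ε ≤ ‖Q * Qᴴ - Qᴴ * Q‖ ^ 2 + t ^ 2 := by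
  have : ProperSpace (Matrix m m ℂ) := FiniteDimensional.proper ℂ _
  let K : Set (Matrix m m ℂ × ℝ) := (Metric.sphere 0 1 ×ˢ Set.Icc 0 1) ∩
    ⋂ z : ℂ, {p | max (‖z‖ - p.2 * B) 0 ^ Fintype.card m ≤ ‖p.1.charpoly.eval z‖}
  have hK : IsCompact K := by
    refine ((isCompact_sphere _ _).prod isCompact_Icc).inter_right
      (isClosed_iInter fun z => isClosed_le (by fun_prop) ?_)
    exact ((Matrix.continuous_eval_charpoly z).comp continuous_fst).norm
  have hf : Continuous fun p : Matrix m m ℂ × ℝ =>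
      ‖p.1 * p.1ᴴ - p.1ᴴ * p.1‖ ^ 2 + p.2 ^ 2 := by
    have hstar : Continuous fun p : Matrix m m ℂ × ℝ => p.1ᴴ :=
      continuous_fst.matrix_conjTranspose
    exact ((((continuous_fst.mul hstar).sub (hstar.mul continuous_fst)).norm.pow 2).add
      (continuous_snd.pow 2))
  obtain ⟨ε, hε, hle⟩ := hK.exists_forall_le' (a := 0) hf.continuousOn (by
    rintro ⟨Q, t⟩ ⟨⟨hQ, -⟩, hz⟩
    refine lt_of_le_of_ne (by positivity) fun h0 => ?_
    dsimp only at h0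
    have ht : t = 0 := by nlinarith [sq_nonneg ‖Q * Qᴴ - Qᴴ * Q‖, sq_nonneg t]
    have hc : Q * Qᴴ - Qᴴ * Q = 0 := by
      rw [← norm_eq_zero]
      nlinarith [sq_nonneg ‖Q * Qᴴ - Qᴴ * Q‖, sq_nonneg t]
    have hnil : IsNilpotent Q := Matrix.isNilpotent_of_forall_eval_charpoly_ne_zero
      fun z hz0 => by
        have := Set.mem_iInter.mp hz z
        simp only [ht, Set.mem_ofPred_eq, zero_mul, sub_zero] at this
        rw [max_eq_left (norm_nonneg z)] at this
        exact norm_pos_iff.mp ((pow_pos (norm_pos_iff.mpr hz0) _).trans_le this)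
    have hQ0 := Matrix.eq_zero_of_isNilpotent_of_commute_conjTranspose hnil (sub_eq_zero.mp hc).symm
    simp [hQ0] at hQ)
  exact ⟨ε, hε, fun Q t hQ ht0 ht1 h => hle (Q, t) ⟨⟨by simpa using hQ, ht0, ht1⟩,
    Set.mem_iInter.mpr fun z => Matrix.pow_le_norm_eval_charpoly h z⟩⟩

/-- Simpson's lemma: for every `n ≥ 1` and every bound `B > 0` on the moduli of the
eigenvalues, there are constants `C₁, C₂ > 0` such that every `n × n` complex matrix `P`
whose spectrum is contained in the closed disc of radius `B` satisfies
`‖[P, Pᴴ]‖² ≥ C₁ ‖P‖⁴ - C₂ (1 + ‖P‖²)` in the Frobenius norm. -/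
theorem simpson_commutator_lower_bound
    (n : ℕ) (hn : 1 ≤ n) (B : ℝ) (hB : 0 < B) :
    ∃ C₁ C₂ : ℝ, 0 < C₁ ∧ 0 < C₂ ∧
      ∀ P : Matrix (Fin n) (Fin n) ℂ,
        (∀ lam ∈ spectrum ℂ P, ‖lam‖ ≤ B) →
        ‖P * Pᴴ - Pᴴ * P‖ ^ 2 ≥ C₁ * ‖P‖ ^ 4 - C₂ * (1 + ‖P‖ ^ 2) := by
  obtain ⟨ε, hε, hle⟩ := Matrix.exists_pos_le_norm_commutator_sq_add_sq (m := Fin n) B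
  refine ⟨ε, 1 + ε, hε, by positivity, fun P hP => ?_⟩
  obtain hlt | hge := lt_or_ge ‖P‖ 1
  · have h4 : ‖P‖ ^ 4 ≤ 1 := pow_le_one₀ (norm_nonneg P) hlt.le
    nlinarith [sq_nonneg ‖P * Pᴴ - Pᴴ * P‖, mul_nonneg hε.le (sq_nonneg ‖P‖), sq_nonneg ‖P‖]
  · have hpos : 0 < ‖P‖ := one_pos.trans_le hge
    set t : ℝ := ‖P‖⁻¹ with ht
    have ht0 : 0 < t := inv_pos.mpr hpos
    have htP : t * ‖P‖ = 1 := inv_mul_cancel₀ hpos.ne'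
    have hnorm : ‖(t : ℂ)‖ = t := by simp [abs_of_pos ht0]
    have h := hle ((t : ℂ) • P) t (by rw [norm_smul, hnorm, htP]) ht0.le
      (inv_le_one_of_one_le₀ hge) (fun lam hl => by
        have hu : (t : ℂ) ≠ 0 := by exact_mod_cast ht0.ne'
        have hmu : (t : ℂ)⁻¹ * lam ∈ spectrum ℂ P := by
          rw [← spectrum.smul_mem_smul_iff (r := Units.mk0 (t : ℂ) hu)]
          simpa [Units.smul_def, mul_inv_cancel_left₀ hu] using hl
        calc ‖lam‖ = t * ‖(t : ℂ)⁻¹ * lam‖ := by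
              rw [norm_mul, norm_inv, hnorm, mul_inv_cancel_left₀ ht0.ne']
          _ ≤ t * B := mul_le_mul_of_nonneg_left (hP _ hmu) ht0.le)
    have hcomm : ((t : ℂ) • P) * ((t : ℂ) • P)ᴴ - ((t : ℂ) • P)ᴴ * ((t : ℂ) • P)
        = ((t : ℂ) * t) • (P * Pᴴ - Pᴴ * P) := by
      have hst : star (t : ℂ) = t := Complex.conj_ofReal t
      rw [Matrix.conjTranspose_smul, hst, smul_mul_smul_comm, smul_mul_smul_comm, smul_sub]
    rw [hcomm, norm_smul, norm_mul, hnorm] at h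
    have h4 : ε * ‖P‖ ^ 4 ≤ ‖P * Pᴴ - Pᴴ * P‖ ^ 2 + ‖P‖ ^ 2 := by
      calc ε * ‖P‖ ^ 4
          ≤ ((t * t * ‖P * Pᴴ - Pᴴ * P‖) ^ 2 + t ^ 2) * ‖P‖ ^ 4 := by gcongr
        _ = (t * ‖P‖) ^ 4 * ‖P * Pᴴ - Pᴴ * P‖ ^ 2 + (t * ‖P‖) ^ 2 * ‖P‖ ^ 2 := by ring
        _ = _ := by rw [htP]; ring
    nlinarith [mul_nonneg hε.le (sq_nonneg ‖P‖), sq_nonneg ‖P‖]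
end

section
/- Let π and φ be n×n complex matrices such that π² = π, πᴴ = π, and (1 − π) φ π = 0. Then tr(π (φ φᴴ − φᴴ φ)) = tr((π φ (1−π)) (π φ (1−π))ᴴ) = ‖π φ (1−π)‖² ≥ 0, where ‖·‖ is the Frobenius norm. -/
open Matrix

attribute [local instance] Matrix.frobeniusNormedAddCommGroup Matrix.frobeniusNormedRing

/-- The squared Frobenius norm of `A` is the trace of `A * Aᴴ`. -/
theorem trace_mul_conjTranspose_self_eq_frobenius_norm_sq {m n 𝕜 : Type*} [Fintype m] [Fintype n]
    [RCLike 𝕜] (A : Matrix m n 𝕜) : (A * Aᴴ).trace = ((‖A‖ ^ 2 : ℝ) : 𝕜) := by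
  have hnonneg : 0 ≤ ∑ i, ∑ j, ‖A i j‖ ^ 2 := by positivity
  simp only [frobenius_norm_def, Real.rpow_two, ← Real.sqrt_eq_rpow, Real.sq_sqrt hnonneg]
  simp [trace, mul_apply, RCLike.mul_conj]

/-- If the range of the self-adjoint idempotent `p` is invariant under `φ`, the trace of
`p * [φ, φᴴ]` only depends on the off-diagonal block `p * φ * (1 - p)`. -/
theorem trace_proj_mul_commutator_conjTranspose {n R : Type*} [Fintype n] [DecidableEq n]
    [CommRing R] [StarRing R] {p φ : Matrix n n R} (hproj : p * p = p) (hsa : pᴴ = p)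
    (hinv : (1 - p) * φ * p = 0) :
    (p * (φ * φᴴ - φᴴ * φ)).trace = ((p * φ * (1 - p)) * (p * φ * (1 - p))ᴴ).trace := by
  have hcompl : (1 - p) * (1 - p) = 1 - p := by
    simp [mul_sub, sub_mul, hproj]
  have hφ : p * φ * p = φ * p := by
    rw [sub_mul, sub_mul, one_mul, sub_eq_zero] at hinv
    exact hinv.symm
  have hright : ((p * φ * (1 - p)) * (p * φ * (1 - p))ᴴ).trace =
      (p * φ * (1 - p) * φᴴ).trace := by
    have hexpand : (p * φ * (1 - p)) * (p * φ * (1 - p))ᴴ =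
        (p * φ * ((1 - p) * (1 - p)) * φᴴ) * p := by
      simp only [conjTranspose_mul, conjTranspose_sub, conjTranspose_one, hsa, Matrix.mul_assoc]
    rw [hexpand, hcompl, trace_mul_comm]
    simp only [← Matrix.mul_assoc, hproj]
  have hcross : (p * φ * p * φᴴ).trace = (p * φᴴ * φ).trace := by
    rw [hφ, Matrix.mul_assoc, trace_mul_comm]
  rw [hright, mul_sub, mul_sub, mul_one, sub_mul, trace_sub, trace_sub, hcross,
    Matrix.mul_assoc p φ, Matrix.mul_assoc p φᴴ]

/-- The pointwise identity (2.20) of the paper: if `π` is an orthogonal projection whose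
range is invariant under `φ`, then
`tr(π (φ φᴴ - φᴴ φ)) = tr((π φ (1-π)) (π φ (1-π))ᴴ) = ‖π φ (1-π)‖² ≥ 0`
in the Frobenius norm. -/
theorem trace_proj_commutator_eq_sq_norm
    (n : ℕ) (p φ : Matrix (Fin n) (Fin n) ℂ)
    (hproj : p * p = p) (hsa : pᴴ = p) (hinv : (1 - p) * φ * p = 0) :
    (p * (φ * φᴴ - φᴴ * φ)).trace
        = ((p * φ * (1 - p)) * (p * φ * (1 - p))ᴴ).trace ∧
    (p * (φ * φᴴ - φᴴ * φ)).trace = (‖p * φ * (1 - p)‖ ^ 2 : ℝ) ∧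
    (0 : ℝ) ≤ ‖p * φ * (1 - p)‖ ^ 2 := by
  have htrace := trace_proj_mul_commutator_conjTranspose hproj hsa hinv
  exact ⟨htrace, htrace.trans (trace_mul_conjTranspose_self_eq_frobenius_norm_sq _), sq_nonneg _⟩
end

section
/- Let n₁, n₂ ≥ 1 be integers and set n = n₁ + n₂. For an integer m ≥ 1 define μ^{(m)}_i = m + 1 − 2i for i = 1, …, m. Let λ₁ ≥ λ₂ ≥ … ≥ λ_n be the decreasing rearrangement of the multiset obtained as the union of {μ^{(n₁)}_i : 1 ≤ i ≤ n₁} and {μ^{(n₂)}_j : 1 ≤ j ≤ n₂}. Then for every k with 1 ≤ k ≤ n one has Σ_{i=1}^{k} λ_i ≤ Σ_{i=1}^{k} μ^{(n)}_i, and the inequality is strict for k = 1. -/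
open Finset

/-- A sub-multiset of an image is the image of a sub-multiset. -/
theorem exists_le_map_eq_of_le_map {α β : Type*} {f : α → β} {s : Multiset α} {t : Multiset β}
    (h : t ≤ Multiset.map f s) : ∃ u ≤ s, Multiset.map f u = t := by
  induction s using Quotient.inductionOn with | _ l
  induction t using Quotient.inductionOn with | _ r
  obtain ⟨r', hperm, hsub⟩ : r.Subperm (l.map f) := h
  obtain ⟨l', hl', rfl⟩ := List.sublist_map_iff.1 hsub
  exact ⟨l', hl'.subperm, Multiset.coe_eq_coe.2 hperm⟩

/-- A finite set of positive integers has sum at least that of the first `#s` ones. -/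
theorem card_mul_card_add_one_le_two_mul_sum (s : Finset ℕ) (hs : ∀ i ∈ s, 1 ≤ i) :
    (s.card : ℤ) * (s.card + 1) ≤ 2 * ∑ i ∈ s, (i : ℤ) := by
  induction s using Finset.induction_on_max with
  | empty => simp
  | insert a s hlt ih =>
    have ha : a ∉ s := fun h => (hlt a h).false
    have hsub : s ⊆ Ico 1 a := fun i hi =>
      mem_Ico.2 ⟨hs i (mem_insert_of_mem hi), hlt i hi⟩
    have hcard := card_le_card hsub
    rw [Nat.card_Ico] at hcard
    have ha1 := hs a (mem_insert_self a s)
    have hle : (s.card : ℤ) + 1 ≤ a := by omega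
    have ih' := ih fun i hi => hs i (mem_insert_of_mem hi)
    rw [card_insert_of_notMem ha, sum_insert ha]
    push_cast
    linarith

/-- A sub-multiset of the rank-`m` oper slopes with `a` elements has `a ≤ m` and sum at most
`a * (m - a)`. -/
theorem card_le_and_sum_le_of_le_oper_slopes (m : ℕ) (A : Multiset ℤ)
    (hA : A ≤ Multiset.map (fun i : ℕ => (m : ℤ) + 1 - 2 * i) (Icc 1 m).val) :
    A.card ≤ m ∧ A.sum ≤ (A.card : ℤ) * (m - A.card) := by
  refine ⟨by simpa using Multiset.card_le_card hA, ?_⟩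
  obtain ⟨u, hu, rfl⟩ := exists_le_map_eq_of_le_map hA
  let s : Finset ℕ := ⟨u, Multiset.nodup_of_le hu (Icc 1 m).nodup⟩
  have hs := card_mul_card_add_one_le_two_mul_sum s fun i hi =>
    (mem_Icc.1 (Multiset.mem_of_le hu hi)).1
  have hsum : (Multiset.map (fun i : ℕ => (m : ℤ) + 1 - 2 * i) u).sum =
      ∑ i ∈ s, ((m : ℤ) + 1 - 2 * i) := rfl
  have hcard : u.card = s.card := rfl
  rw [hsum, Multiset.card_map, hcard, sum_sub_distrib, ← mul_sum, sum_const, nsmul_eq_mul]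
  linarith

theorem sum_oper_slopes (n k : ℕ) :
    ∑ i ∈ Icc 1 k, ((n : ℤ) + 1 - 2 * i) = k * (n - k) := by
  induction k with
  | zero => simp
  | succ k ih =>
    rw [sum_Icc_succ_top (by omega), ih]
    push_cast
    ring

/-- Majorization step in the proof of Proposition 4.34 of the paper: the decreasing
rearrangement `lam` of the union of the oper slope-multisets `{n₁+1-2i}` and `{n₂+1-2j}`
is dominated by the rank-`n` oper slopes `{n+1-2i}` (with strict inequality at `k = 1`),
where `n = n₁ + n₂`. -/
theorem oper_type_majorization
    (n₁ n₂ : ℕ) (h₁ : 1 ≤ n₁) (h₂ : 1 ≤ n₂) (n : ℕ) (hn : n = n₁ + n₂)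
    (lam : ℕ → ℤ)
    (hanti : ∀ i j : ℕ, 1 ≤ i → i ≤ j → j ≤ n → lam j ≤ lam i)
    (hmem : Multiset.map lam (Icc 1 n).val =
      Multiset.map (fun i : ℕ => (n₁ : ℤ) + 1 - 2 * i) (Icc 1 n₁).val +
      Multiset.map (fun i : ℕ => (n₂ : ℤ) + 1 - 2 * i) (Icc 1 n₂).val) :
    (∀ k, 1 ≤ k → k ≤ n →
        ∑ i ∈ Icc 1 k, lam i ≤ ∑ i ∈ Icc 1 k, ((n : ℤ) + 1 - 2 * i)) ∧
      ∑ i ∈ Icc 1 1, lam i < ∑ i ∈ Icc 1 1, ((n : ℤ) + 1 - 2 * i) := by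
  constructor
  · intro k _ hkn
    set S := Multiset.map lam (Icc 1 k).val with hS
    set M₁ := Multiset.map (fun i : ℕ => (n₁ : ℤ) + 1 - 2 * i) (Icc 1 n₁).val with hM₁
    have hle : S ≤ Multiset.map lam (Icc 1 n).val :=
      Multiset.map_le_map (val_le_iff.2 (Icc_subset_Icc_right hkn))
    rw [hmem] at hle
    obtain ⟨ha, hA⟩ := card_le_and_sum_le_of_le_oper_slopes n₁ (S ∩ M₁) Multiset.inter_le_right
    obtain ⟨hb, hB⟩ := card_le_and_sum_le_of_le_oper_slopes n₂ (S - M₁)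
      (Multiset.sub_le_iff_le_add'.2 hle)
    have hsplit : S - M₁ + S ∩ M₁ = S := Multiset.sub_add_inter S M₁
    have hsum : (S - M₁).sum + (S ∩ M₁).sum = ∑ i ∈ Icc 1 k, lam i := by
      rw [← Multiset.sum_add, hsplit]
      rfl
    have hcard : (S - M₁).card + (S ∩ M₁).card = k := by
      rw [← Multiset.card_add, hsplit]
      simp [hS]
    rw [sum_oper_slopes, ← hsum, hn, ← hcard]
    generalize (S - M₁).card = b at *
    generalize (S ∩ M₁).card = a at *
    have hab : (0 : ℤ) ≤ a * (n₂ - b) := mul_nonneg (by omega) (by omega)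
    have hba : (0 : ℤ) ≤ b * (n₁ - a) := mul_nonneg (by omega) (by omega)
    push_cast
    linarith
  · have h : lam 1 ∈ Multiset.map lam (Icc 1 n).val :=
      Multiset.mem_map_of_mem lam (mem_def.1 (mem_Icc.2 ⟨le_rfl, by omega⟩))
    rw [hmem, Multiset.mem_add, Multiset.mem_map, Multiset.mem_map] at h
    simp only [mem_val, mem_Icc] at h
    simp only [Icc_self, sum_singleton]
    omega
end
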